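/- Let m ≥ 1 and let M be an invertible 2m×2m matrix over the field GF(2) with two elements. Then M cannot be written as a product of fewer than 3m bijective linear instructions over GF(2) if and only if M is the permutation matrix of a fixed-point-free involution of {1,…,2m} (i.e. M is a permutation matrix, M² = I, and M has no nonzero diagonal entry). -/

import Mathlib

/-- A linear instruction: an `n × n` matrix over `F` that differs from the identity
matrix in at most one row. -/
def Matrix.IsLinearInstruction {F : Type*} [Semiring F] {n : ℕ}
    (M : Matrix (Fin n) (Fin n) F) : Prop :=
  ∃ i : Fin n, ∀ j : Fin n, j ≠ i → M j = (1 : Matrix (Fin n) (Fin n) F) j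

namespace Matrix

variable {F : Type*} [Field F] {n : ℕ}

/-- `M` is a product of `k` bijective linear instructions. -/
def IsInstructionProduct (k : ℕ) (M : Matrix (Fin n) (Fin n) F) : Prop :=
  ∃ L : List (Matrix (Fin n) (Fin n) F),
    (∀ A ∈ L, IsUnit A ∧ A.IsLinearInstruction) ∧ L.prod = M ∧ L.length = k

theorem isInstructionProduct_one : IsInstructionProduct 0 (1 : Matrix (Fin n) (Fin n) F) :=
  ⟨[], by simp, rfl, rfl⟩

theorem IsInstructionProduct.mul {k l : ℕ} {A B : Matrix (Fin n) (Fin n) F}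
    (hA : IsInstructionProduct k A) (hB : IsInstructionProduct l B) :
    IsInstructionProduct (k + l) (A * B) := by
  obtain ⟨L, hL, rfl, rfl⟩ := hA
  obtain ⟨L', hL', rfl, rfl⟩ := hB
  refine ⟨L ++ L', fun A hA => ?_, List.prod_append, List.length_append⟩
  exact (List.mem_append.1 hA).elim (hL A) (hL' A)

theorem mul_inv_row_eq_one {H N : Matrix (Fin n) (Fin n) F} (hH : IsUnit H) {a : Fin n}
    (h : N a = H a) : (N * H⁻¹) a = (1 : Matrix (Fin n) (Fin n) F) a := by
  rw [← mul_nonsing_inv H ((isUnit_iff_isUnit_det H).1 hH)]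
  ext j
  simp only [mul_apply, h]

/-- Replacing one row of a product of `k` instructions costs one more instruction. -/
theorem IsInstructionProduct.updateRow {k : ℕ} {H : Matrix (Fin n) (Fin n) F}
    (hk : IsInstructionProduct k H) (hH : IsUnit H) (i : Fin n) (v : Fin n → F)
    (hv : IsUnit (H.updateRow i v)) : IsInstructionProduct (k + 1) (H.updateRow i v) := by
  have hd := (isUnit_iff_isUnit_det H).1 hH
  have h1 : IsInstructionProduct 1 (H.updateRow i v * H⁻¹) := by
    refine ⟨[H.updateRow i v * H⁻¹], ?_, by simp, rfl⟩
    simp only [List.mem_singleton, forall_eq]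
    refine ⟨hv.mul ?_, i, fun j hj => mul_inv_row_eq_one hH (updateRow_ne hj)⟩
    rw [isUnit_nonsing_inv_iff]
    exact hH
  have := h1.mul hk
  rwa [nonsing_inv_mul_cancel_right _ _ hd, add_comm] at this

theorem isUnit_of_mulVec_eq_zero {H : Matrix (Fin n) (Fin n) F}
    (h : ∀ x, H *ᵥ x = 0 → x = 0) : IsUnit H := by
  rw [← mulVec_injective_iff_isUnit]
  intro x y hxy
  refine sub_eq_zero.1 (h _ ?_)
  rw [mulVec_sub, sub_eq_zero]
  exact hxy

/-- A matrix whose rows outside `U` are those of the identity is invertible as soon as its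
kernel contains no nonzero vector supported on `U`. -/
theorem isUnit_of_rows {H : Matrix (Fin n) (Fin n) F} (U : Finset (Fin n))
    (hU : ∀ l ∉ U, H l = (1 : Matrix (Fin n) (Fin n) F) l)
    (h : ∀ x, (∀ u : Fin n → F, u ⬝ᵥ x = ∑ a ∈ U, u a * x a) →
      (∀ a ∈ U, H a ⬝ᵥ x = 0) → ∀ a ∈ U, x a = 0) : IsUnit H := by
  refine isUnit_of_mulVec_eq_zero fun x hx => ?_
  have hx0 : ∀ l ∉ U, x l = 0 := fun l hl => by
    have := congrFun hx l
    rw [mulVec, hU l hl] at this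
    simpa [one_apply, dotProduct] using this
  have key := h x (fun u => (Finset.sum_subset (Finset.subset_univ U)
    (fun a _ ha => by rw [hx0 a ha, mul_zero])).symm) (fun a _ => congrFun hx a)
  ext a
  by_cases ha : a ∈ U
  · exact key a ha
  · exact hx0 a ha

theorem isUnit_updateRow_one {i : Fin n} {v : Fin n → F} (hv : v i ≠ 0) :
    IsUnit ((1 : Matrix (Fin n) (Fin n) F).updateRow i v) := by
  refine isUnit_of_rows {i} (fun l hl => updateRow_ne (by simpa using hl)) fun x hs hx a ha => ?_
  have h := hx i (by simp)
  rw [hs] at h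
  obtain rfl := Finset.mem_singleton.1 ha
  simpa [hv] using h

/-- One instruction turns row `i` into row `i` of `N` when the corresponding diagonal entry
is nonzero. -/
theorem exists_product_of_diag (N : Matrix (Fin n) (Fin n) F) {i : Fin n} (h : N i i ≠ 0) :
    ∃ H : Matrix (Fin n) (Fin n) F, IsUnit H ∧ IsInstructionProduct 1 H ∧
      H i = N i ∧ ∀ l ≠ i, H l = (1 : Matrix (Fin n) (Fin n) F) l :=
  ⟨_, isUnit_updateRow_one h,
    isInstructionProduct_one.updateRow isUnit_one i _ (isUnit_updateRow_one h),
    updateRow_self, fun _ hl => updateRow_ne hl⟩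

/-- Three instructions perform an exchange of two coordinates. -/
theorem exists_product_of_swap (N : Matrix (Fin n) (Fin n) F) {i j : Fin n} (hij : i ≠ j)
    (hii : N i i = 0) (hjj : N j j = 0) (h1 : N i j = 1) (h2 : N j i = 1) :
    ∃ H : Matrix (Fin n) (Fin n) F, IsUnit H ∧ IsInstructionProduct 3 H ∧
      H i = N i ∧ H j = N j ∧
      ∀ l, l ≠ i → l ≠ j → H l = (1 : Matrix (Fin n) (Fin n) F) l := by
  let r : Fin n → F := Pi.single i 1 + Pi.single j 1
  have u1 : IsUnit ((1 : Matrix (Fin n) (Fin n) F).updateRow i r) :=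
    isUnit_updateRow_one (by simp [r, hij])
  have u2 : IsUnit (((1 : Matrix (Fin n) (Fin n) F).updateRow i r).updateRow j (N j)) := by
    refine isUnit_of_rows {i, j} (fun l hl => ?_) fun x hs hx => ?_
    · simp only [Finset.mem_insert, Finset.mem_singleton, not_or] at hl
      simp [updateRow_ne, hl]
    · simp [hs, r, updateRow_apply, hij, hij.symm, hjj, h2] at hx ⊢
      grind
  have u3 : IsUnit ((((1 : Matrix (Fin n) (Fin n) F).updateRow i r).updateRow j
      (N j)).updateRow i (N i)) := by
    refine isUnit_of_rows {i, j} (fun l hl => ?_) fun x hs hx => ?_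
    · simp only [Finset.mem_insert, Finset.mem_singleton, not_or] at hl
      simp [updateRow_ne, hl]
    · simp [hs, updateRow_apply, hij, hij.symm, hii, hjj, h1, h2] at hx ⊢
      grind
  refine ⟨_, u3, ((isInstructionProduct_one.updateRow isUnit_one _ _ u1).updateRow u1 _ _
    u2).updateRow u2 _ _ u3, updateRow_self, ?_, fun l hi hj => ?_⟩
  · simp [updateRow_ne, hij.symm]
  · simp [updateRow_ne, hi, hj]

/-- Four instructions perform a cyclic shift of three coordinates. -/
theorem exists_product_of_three_cycle (N : Matrix (Fin n) (Fin n) F) {i j k : Fin n}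
    (hij : i ≠ j) (hik : i ≠ k) (hjk : j ≠ k)
    (hii : N i i = 0) (hij0 : N i j = 0) (hik1 : N i k = 1)
    (hji : N j i = 1) (hjj : N j j = 0) (hjk0 : N j k = 0)
    (hki : N k i = 0) (hkj : N k j = 1) (hkk : N k k = 0) :
    ∃ H : Matrix (Fin n) (Fin n) F, IsUnit H ∧ IsInstructionProduct 4 H ∧
      H i = N i ∧ H j = N j ∧ H k = N k ∧
      ∀ l, l ≠ i → l ≠ j → l ≠ k → H l = (1 : Matrix (Fin n) (Fin n) F) l := by
  let r : Fin n → F := Pi.single i 1 + Pi.single j 1 + Pi.single k 1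
  have u1 : IsUnit ((1 : Matrix (Fin n) (Fin n) F).updateRow i r) :=
    isUnit_updateRow_one (by simp [r, hij, hik])
  have u2 : IsUnit (((1 : Matrix (Fin n) (Fin n) F).updateRow i r).updateRow j (N j)) := by
    refine isUnit_of_rows {i, j} (fun l hl => ?_) fun x hs hx => ?_
    · simp only [Finset.mem_insert, Finset.mem_singleton, not_or] at hl
      simp [updateRow_ne, hl]
    · simp [hs, r, updateRow_apply, hij, hij.symm, hik, hjk, hjj, hji] at hx ⊢
      grind
  have u3 : IsUnit ((((1 : Matrix (Fin n) (Fin n) F).updateRow i r).updateRow j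
      (N j)).updateRow k (N k)) := by
    refine isUnit_of_rows {i, j, k} (fun l hl => ?_) fun x hs hx => ?_
    · simp only [Finset.mem_insert, Finset.mem_singleton, not_or] at hl
      simp [updateRow_ne, hl]
    · simp [hs, r, updateRow_apply, hij, hij.symm, hik, hik.symm, hjk, hjk.symm, hjj, hji,
        hjk0, hki, hkj, hkk] at hx ⊢
      grind
  have u4 : IsUnit (((((1 : Matrix (Fin n) (Fin n) F).updateRow i r).updateRow j
      (N j)).updateRow k (N k)).updateRow i (N i)) := by
    refine isUnit_of_rows {i, j, k} (fun l hl => ?_) fun x hs hx => ?_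
    · simp only [Finset.mem_insert, Finset.mem_singleton, not_or] at hl
      simp [updateRow_ne, hl]
    · simp [hs, updateRow_apply, hij, hij.symm, hik, hik.symm, hjk, hjj, hji,
        hjk0, hki, hkj, hkk, hii, hij0, hik1] at hx ⊢
      grind
  refine ⟨_, u4, (((isInstructionProduct_one.updateRow isUnit_one _ _ u1).updateRow u1 _ _
    u2).updateRow u2 _ _ u3).updateRow u3 _ _ u4, updateRow_self, ?_, ?_, fun l hi hj hk => ?_⟩
  · simp [updateRow_ne, hij.symm, hjk]
  · simp [updateRow_ne, hik.symm]
  · simp [updateRow_ne, hi, hj, hk]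

/-- If the rows `j, k, l` and the columns `i, j, k` of `N` carry unit leading minors, then four
instructions suffice to install the rows `j, k, l` of `N`. -/
theorem exists_product_of_chain (N : Matrix (Fin n) (Fin n) F) {i j k l : Fin n}
    (hij : i ≠ j) (hik : i ≠ k) (hil : i ≠ l) (hjk : j ≠ k) (hjl : j ≠ l) (hkl : k ≠ l)
    (hji : N j i = 1) (hjj : N j j = 0) (hkj : N k j = 1) (hkk : N k k = 0)
    (hminor : N l k + N j k * (N k i * N l j - N l i) = 1) :
    ∃ H : Matrix (Fin n) (Fin n) F, IsUnit H ∧ IsInstructionProduct 4 H ∧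
      H j = N j ∧ H k = N k ∧ H l = N l ∧
      ∀ a, a ≠ i → a ≠ j → a ≠ k → a ≠ l → H a = (1 : Matrix (Fin n) (Fin n) F) a := by
  -- the vector `(zi, zj, zk, 1)` is annihilated by the rows `j, k, l`
  obtain ⟨zk, hzk⟩ : ∃ z, z = N l i * N j l + N l j * N k l - N l j * N k i * N j l - N l l :=
    ⟨_, rfl⟩
  obtain ⟨zi, hzi⟩ : ∃ z, z = - N j k * zk - N j l := ⟨_, rfl⟩
  obtain ⟨zj, hzj⟩ : ∃ z, z = - N k i * zi - N k l := ⟨_, rfl⟩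
  obtain ⟨s, hs⟩ : ∃ s, s = 1 + N j k - N k i * N j k := ⟨_, rfl⟩
  obtain ⟨t, ht⟩ : ∃ t, t = 1 - zi - zj - s * zk := ⟨_, rfl⟩
  let r : Fin n → F := Pi.single i 1 + Pi.single j 1 + s • Pi.single k 1 + t • Pi.single l 1
  have u1 : IsUnit ((1 : Matrix (Fin n) (Fin n) F).updateRow i r) :=
    isUnit_updateRow_one (by simp [r, hij, hik, hil])
  have u2 : IsUnit (((1 : Matrix (Fin n) (Fin n) F).updateRow i r).updateRow j (N j)) := by
    refine isUnit_of_rows {i, j} (fun l hl => ?_) fun x hs hx => ?_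
    · simp only [Finset.mem_insert, Finset.mem_singleton, not_or] at hl
      simp [updateRow_ne, hl]
    · simp [hs, r, updateRow_apply, hij, hij.symm, hik, hjk, hjj, hji, hil, hjl] at hx ⊢
      grind
  have u3 : IsUnit ((((1 : Matrix (Fin n) (Fin n) F).updateRow i r).updateRow j
      (N j)).updateRow k (N k)) := by
    refine isUnit_of_rows {i, j, k} (fun l hl => ?_) fun x hs hx => ?_
    · simp only [Finset.mem_insert, Finset.mem_singleton, not_or] at hl
      simp [updateRow_ne, hl]
    · simp [hs, r, updateRow_apply, hij, hij.symm, hik, hik.symm, hjk, hjk.symm, hjj, hji,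
        hkj, hkk, hil, hjl, hkl] at hx ⊢
      obtain ⟨e1, e2, e3⟩ := hx
      have hk : x k = 0 := by grind
      grind
  have u4 : IsUnit (((((1 : Matrix (Fin n) (Fin n) F).updateRow i r).updateRow j
      (N j)).updateRow k (N k)).updateRow l (N l)) := by
    refine isUnit_of_rows {i, j, k, l} (fun l hl => ?_) fun x hs hx => ?_
    · simp only [Finset.mem_insert, Finset.mem_singleton, not_or] at hl
      simp [updateRow_ne, hl]
    · simp [hs, r, updateRow_apply, hij, hij.symm, hik, hik.symm, hjk, hjk.symm, hjj, hji,
        hkj, hkk, hil, hjl, hkl, hil.symm, hjl.symm, hkl.symm] at hx ⊢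
      obtain ⟨e1, e2, e3, e4⟩ := hx
      have f1 : x i = - N j k * x k - N j l * x l := by linear_combination e2
      have f2 : x j = - N k i * x i - N k l * x l := by linear_combination e3
      have f3 : x k = zk * x l := by
        rw [f2, f1] at e4
        rw [hzk]
        linear_combination e4 - x k * hminor
      have f4 : x i = zi * x l := by rw [f1, f3, hzi]; ring
      have f5 : x j = zj * x l := by rw [f2, f4, hzj]; ring
      have f6 : x l = 0 := by
        rw [f3, f4, f5] at e1
        linear_combination e1 - x l * ht
      simp [f3, f4, f5, f6]
  refine ⟨_, u4, (((isInstructionProduct_one.updateRow isUnit_one _ _ u1).updateRow u1 _ _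
    u2).updateRow u2 _ _ u3).updateRow u3 _ _ u4, ?_, ?_, updateRow_self,
    fun a hi hj hk hl => ?_⟩
  · simp [updateRow_ne, hjk, hjl]
  · simp [updateRow_ne, hkl]
  · simp [updateRow_ne, hi, hj, hk, hl]

theorem exists_ne_zero_of_isUnit {N : Matrix (Fin n) (Fin n) F} (hN : IsUnit N)
    {S : Finset (Fin n)} (hS : ∀ s ∈ S, N s = (1 : Matrix (Fin n) (Fin n) F) s)
    {i : Fin n} (hi : i ∉ S) : ∃ k ∉ S, N k i ≠ 0 := by
  by_contra! h
  have h0 : N *ᵥ Pi.single i 1 = N *ᵥ 0 := by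
    ext k
    by_cases hk : k ∈ S
    · have : k ≠ i := fun e => hi (e ▸ hk)
      simp [hS k hk, this]
    · simp [h k hk]
  have := congrFun (mulVec_injective_iff_isUnit.2 hN h0) i
  simp at this

/-- The rows and columns of `N` outside `S` form the permutation matrix of a fixed-point-free
involution. -/
def IsFixedPointFreeInvolutionOff (N : Matrix (Fin n) (Fin n) F) (S : Finset (Fin n)) : Prop :=
  ∃ σ : Fin n → Fin n, ∀ a ∉ S, σ a ∉ S ∧ σ (σ a) = a ∧ σ a ≠ a ∧
    ∀ b ∉ S, N a b = if σ a = b then 1 else 0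

/-- `N` is a product of fewer than `3 * t / 2` bijective instructions, where `t` is the number of rows
outside `S`. -/
def HasShortProductOff (N : Matrix (Fin n) (Fin n) F) (S : Finset (Fin n)) : Prop :=
  ∃ k, 2 * k < 3 * Sᶜ.card ∧ IsInstructionProduct k N

/-- If `N` and `H` agree on the rows in `S ∪ U`, then these rows of `N * H⁻¹` are in place. -/
theorem rows_mul_inv {N H : Matrix (Fin n) (Fin n) F} (hH : IsUnit H) {S U : Finset (Fin n)}
    (hS : ∀ s ∈ S, N s = (1 : Matrix (Fin n) (Fin n) F) s) (hHU : ∀ a ∈ U, H a = N a)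
    (hHS : ∀ s ∈ S, H s = (1 : Matrix (Fin n) (Fin n) F) s) :
    ∀ s ∈ S ∪ U, (N * H⁻¹) s = (1 : Matrix (Fin n) (Fin n) F) s := fun s hs =>
  mul_inv_row_eq_one hH <| (Finset.mem_union.1 hs).elim
    (fun h => (hS s h).trans (hHS s h).symm) fun h => (hHU s h).symm

theorem card_compl_union {S U : Finset (Fin n)} (h : ∀ a ∈ U, a ∉ S) :
    (S ∪ U)ᶜ.card + U.card = Sᶜ.card := by
  have h1 := Finset.card_union_of_disjoint (Finset.disjoint_right.2 h)
  have h2 := Finset.card_add_card_compl (S ∪ U)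
  have h3 := Finset.card_add_card_compl S
  omega

theorem IsInstructionProduct.of_mul_inv {N H : Matrix (Fin n) (Fin n) F} (hH : IsUnit H)
    {k l : ℕ} (hl : IsInstructionProduct l (N * H⁻¹)) (hk : IsInstructionProduct k H) :
    IsInstructionProduct (l + k) N := by
  have := hl.mul hk
  rwa [nonsing_inv_mul_cancel_right _ _ ((isUnit_iff_isUnit_det H).1 hH)] at this

theorem ZMod_two_eq_one {a : ZMod 2} (h : a ≠ 0) : a = 1 := by
  revert a; decide

/-- Every invertible matrix over `GF(2)` whose rows in `S` are in place is a product of fewer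
than `3 * t / 2` instructions, where `t` is the number of remaining rows, or else it is a
fixed-point-free involution on these rows and `3 * t / 2` instructions suffice. -/
theorem hasShortProductOff_or (t : ℕ) :
    ∀ (N : Matrix (Fin n) (Fin n) (ZMod 2)) (S : Finset (Fin n)), Sᶜ.card = t → IsUnit N →
      (∀ s ∈ S, N s = (1 : Matrix (Fin n) (Fin n) (ZMod 2)) s) →
      N.HasShortProductOff S ∨ N.IsFixedPointFreeInvolutionOff S ∧
        ∃ k, 2 * k ≤ 3 * t ∧ IsInstructionProduct k N := by
  induction t using Nat.strong_induction_on with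
  | _ t ih =>
  intro N S ht hN hS
  have hinv {H : Matrix (Fin n) (Fin n) (ZMod 2)} (hH : IsUnit H) : IsUnit (N * H⁻¹) :=
    hN.mul ((isUnit_nonsing_inv_iff).2 hH)
  -- installing `U` at a cost of less than `3/2` instructions per row
  have cheap : ∀ (U : Finset (Fin n)) (H : Matrix (Fin n) (Fin n) (ZMod 2)) (c : ℕ),
      IsUnit H → IsInstructionProduct c H → (∀ a ∈ U, a ∉ S) → (∀ a ∈ U, H a = N a) →
      (∀ s ∈ S, H s = (1 : Matrix (Fin n) (Fin n) (ZMod 2)) s) → 2 * c < 3 * U.card →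
      N.HasShortProductOff S := by
    intro U H c hH hc hU hHU hHS hlt
    have hcard := card_compl_union hU
    obtain ⟨k, hk, hk'⟩ : ∃ k, 2 * k ≤ 3 * (S ∪ U)ᶜ.card ∧
        IsInstructionProduct k (N * H⁻¹) := by
      obtain ⟨k, hk, h⟩ | ⟨-, h⟩ := ih _ (by omega) (N * H⁻¹) (S ∪ U) rfl (hinv hH)
        (rows_mul_inv hH hS hHU hHS)
      · exact ⟨k, hk.le, h⟩
      · exact h
    exact ⟨k + c, by omega, hk'.of_mul_inv hH hc⟩
  have chain : ∀ i j k l : Fin n, i ∉ S → j ∉ S → k ∉ S → l ∉ S →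
      i ≠ j → i ≠ k → i ≠ l → j ≠ k → j ≠ l → k ≠ l →
      N j i = 1 → N j j = 0 → N k j = 1 → N k k = 0 →
      N l k + N j k * (N k i * N l j - N l i) = 1 → N.HasShortProductOff S := by
    intro i j k l hi hj hk hl hij hik hil hjk hjl hkl h1 h2 h3 h4 h5
    obtain ⟨H, hH, hc, ej, ek, el, hrest⟩ :=
      exists_product_of_chain N hij hik hil hjk hjl hkl h1 h2 h3 h4 h5
    refine cheap {j, k, l} H 4 hH hc ?_ ?_ (fun s hs => hrest s ?_ ?_ ?_ ?_) ?_
    · simp [hj, hk, hl]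
    · simp [ej, ek, el]
    iterate 4 (rintro rfl; contradiction)
    · rw [Finset.card_eq_three.2 ⟨j, k, l, hjk, hjl, hkl, rfl⟩]; norm_num
  by_cases hdiag : ∃ i ∉ S, N i i ≠ 0
  · obtain ⟨i, hi, hii⟩ := hdiag
    obtain ⟨H, hH, hc, ei, hrest⟩ := exists_product_of_diag N hii
    refine Or.inl (cheap {i} H 1 hH hc (by simpa using hi) (by simpa using ei)
      (fun s hs => hrest s ?_) (by simp))
    rintro rfl
    contradiction
  push Not at hdiag
  by_cases hswap : ∃ i ∉ S, ∃ j ∉ S, N i j ≠ 0 ∧ N j i ≠ 0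
  · obtain ⟨i, hi, j, hj, h1, h2⟩ := hswap
    replace h1 := ZMod_two_eq_one h1
    replace h2 := ZMod_two_eq_one h2
    have hij : i ≠ j := by
      rintro rfl
      simp [hdiag i hi] at h1
    obtain ⟨H, hH, hc, ei, ej, hrest⟩ :=
      exists_product_of_swap N hij (hdiag i hi) (hdiag j hj) h1 h2
    have hU : ∀ a ∈ ({i, j} : Finset (Fin n)), a ∉ S := by simp [hi, hj]
    have hcard := card_compl_union hU
    rw [Finset.card_pair hij] at hcard
    have hHS : ∀ s ∈ S, H s = (1 : Matrix (Fin n) (Fin n) (ZMod 2)) s := fun s hs =>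
      hrest s (by rintro rfl; contradiction) (by rintro rfl; contradiction)
    have hHU : ∀ a ∈ ({i, j} : Finset (Fin n)), H a = N a := by simp [ei, ej]
    obtain ⟨k, hk, h⟩ | ⟨⟨σ, hσ⟩, k, hk, h⟩ := ih _ (by omega) (N * H⁻¹) (S ∪ {i, j}) rfl
      (hinv hH) (rows_mul_inv hH hS hHU hHS)
    · exact Or.inl ⟨k + 3, by omega, h.of_mul_inv hH hc⟩
    rw [or_iff_not_imp_left]
    intro hshort
    refine ⟨?_, k + 3, by omega, h.of_mul_inv hH hc⟩
    set N' := N * H⁻¹ with hN'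
    have hNN' : N = N' * H :=
      (nonsing_inv_mul_cancel_right _ _ ((isUnit_iff_isUnit_det H).1 hH)).symm
    have hentry : ∀ a b, N a b = (if b = i ∨ b = j then 0 else N' a b) +
        (N' a i * N i b + N' a j * N j b) := by
      intro a b
      conv_lhs => rw [hNN', mul_apply]
      rw [← Finset.sum_add_sum_compl {i, j}, Finset.sum_pair hij, ei, ej, add_comm]
      congr 1
      have : ∀ x ∈ ({i, j} : Finset (Fin n))ᶜ, N' a x * H x b = if x = b then N' a b else 0 := by
        intro x hx
        simp only [Finset.mem_compl, Finset.mem_insert, Finset.mem_singleton, not_or] at hx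
        rw [hrest x hx.1 hx.2, one_apply]
        split_ifs with h <;> simp [h]
      rw [Finset.sum_congr rfl this, Finset.sum_ite_eq']
      by_cases hb : b = i ∨ b = j
      · rw [if_neg (by simpa [or_iff_not_imp_left] using hb), if_pos hb]
      · rw [if_pos (by simpa using hb), if_neg hb]
    have hcol_i : ∀ a, N a i = N' a j := fun a => by simp [hentry a i, hdiag i hi, h2]
    have hcol_j : ∀ a, N a j = N' a i := fun a => by simp [hentry a j, hdiag j hj, h1]
    have hoff : ∀ a b, b ≠ i → b ≠ j → N a b = N' a b + (N a j * N i b + N a i * N j b) := by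
      intro a b hbi hbj
      rw [hcol_i, hcol_j, hentry a b]
      simp [hbi, hbj]
    have hmem : ∀ a, a ∉ S → a ≠ i → a ≠ j → a ∉ S ∪ {i, j} := by
      intro a h1 h2 h3; simp [h1, h2, h3]
    have hσ' : ∀ a, a ∉ S → a ≠ i → a ≠ j → σ a ∉ S ∧ σ a ≠ i ∧ σ a ≠ j ∧ σ (σ a) = a ∧
        σ a ≠ a ∧ ∀ b, b ∉ S → b ≠ i → b ≠ j → N' a b = if σ a = b then 1 else 0 := by
      intro a h1 h2 h3
      obtain ⟨q1, q2, q3, q4⟩ := hσ a (hmem a h1 h2 h3)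
      simp only [Finset.mem_union, Finset.mem_insert, Finset.mem_singleton, not_or] at q1
      exact ⟨q1.1, q1.2.1, q1.2.2, q2, q3, fun b e1 e2 e3 => q4 b (hmem b e1 e2 e3)⟩
    -- both columns `i` and `j` vanish on the remaining rows
    have hzi : ∀ a, a ∉ S → a ≠ i → a ≠ j → N a i = 0 := by
      intro a ha hai haj
      by_contra hne
      have hai1 := ZMod_two_eq_one hne
      obtain ⟨q1, q2, q3, q4, q5, q6⟩ := hσ' a ha hai haj
      obtain ⟨-, -, -, -, -, q6'⟩ := hσ' (σ a) q1 q2 q3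
      refine hshort (chain j i a (σ a) hj hi ha q1 hij.symm haj.symm q3.symm hai.symm q2.symm
        q5.symm h1 (hdiag i hi) hai1 (hdiag a ha) ?_)
      have e1 := hoff a a hai haj
      have e2 := hoff (σ a) a hai haj
      rw [q6 a ha hai haj, if_neg q5, hdiag a ha, hai1] at e1
      rw [q6' a ha hai haj, if_pos q4] at e2
      rw [e2]
      linear_combination -N (σ a) i * e1
    have hzj : ∀ a, a ∉ S → a ≠ i → a ≠ j → N a j = 0 := by
      intro a ha hai haj
      by_contra hne
      have haj1 := ZMod_two_eq_one hne
      obtain ⟨q1, q2, q3, q4, q5, q6⟩ := hσ' a ha hai haj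
      obtain ⟨-, -, -, -, -, q6'⟩ := hσ' (σ a) q1 q2 q3
      refine hshort (chain i j a (σ a) hi hj ha q1 hij hai.symm q2.symm haj.symm q3.symm
        q5.symm h2 (hdiag j hj) haj1 (hdiag a ha) ?_)
      have e1 := hoff a a hai haj
      have e2 := hoff (σ a) a hai haj
      rw [q6 a ha hai haj, if_neg q5, hdiag a ha, haj1] at e1
      rw [q6' a ha hai haj, if_pos q4] at e2
      rw [e2]
      linear_combination -N (σ a) j * e1
    have hblock : ∀ a b, a ∉ S → a ≠ i → a ≠ j → b ∉ S → b ≠ i → b ≠ j →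
        N a b = if σ a = b then 1 else 0 := by
      intro a b ha hai haj hb hbi hbj
      rw [hoff a b hbi hbj, hzi a ha hai haj, hzj a ha hai haj,
        (hσ' a ha hai haj).2.2.2.2.2 b hb hbi hbj]
      ring
    -- both rows `i` and `j` vanish on the remaining columns
    have hrow : ∀ u w, u ∉ S → w ∉ S → u ≠ w → N w u = 1 →
        (u = i ∨ u = j) → (w = i ∨ w = j) →
        ∀ a, a ∉ S → a ≠ i → a ≠ j → N u a = 0 := by
      intro u w hu hw huw hwu hu' hw' a ha hai haj
      by_contra hne
      have hua := ZMod_two_eq_one hne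
      obtain ⟨q1, q2, q3, q4, q5, q6⟩ := hσ' a ha hai haj
      have hau : a ≠ u := by rcases hu' with rfl | rfl <;> assumption
      have haw : a ≠ w := by rcases hw' with rfl | rfl <;> assumption
      have hsu : σ a ≠ u := by rcases hu' with rfl | rfl <;> assumption
      have hsw : σ a ≠ w := by rcases hw' with rfl | rfl <;> assumption
      have hz : N a u = 0 := by
        rcases hu' with rfl | rfl
        exacts [hzi a ha hai haj, hzj a ha hai haj]
      refine hshort (chain (σ a) a u w q1 ha hu hw q5 hsu hsw hau haw huw ?_ (hdiag a ha) hua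
        (hdiag u hu) ?_)
      · rw [hblock a (σ a) ha hai haj q1 q2 q3, if_pos rfl]
      · rw [hwu, hz]; ring
    have hri := hrow i j hi hj hij h2 (Or.inl rfl) (Or.inr rfl)
    have hrj := hrow j i hj hi hij.symm h1 (Or.inr rfl) (Or.inl rfl)
    refine ⟨fun a => if a = i then j else if a = j then i else σ a, fun a ha => ?_⟩
    by_cases hai : a = i
    · subst hai
      refine ⟨by simpa using hj, by simp [hij.symm], by simpa using hij.symm, fun b hb => ?_⟩
      by_cases hbj : b = j
      · simp [hbj, h1]
      by_cases hbi : b = a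
      · simp [hbi, hij.symm, hdiag a ha]
      · simp [hri b hb hbi hbj, Ne.symm hbj]
    by_cases haj : a = j
    · subst haj
      refine ⟨by simpa [hai] using hi, by simp [hai], by simp [hai, Ne.symm hai], fun b hb => ?_⟩
      by_cases hbi : b = i
      · simp [hbi, h2, hai]
      by_cases hbj : b = a
      · simp [hbj, Ne.symm hai, hai, hdiag a ha]
      · simp [hrj b hb hbi hbj, hai, Ne.symm hbi]
    · obtain ⟨q1, q2, q3, q4, q5, -⟩ := hσ' a ha hai haj
      refine ⟨by simpa [hai, haj] using q1, by simp [hai, haj, q2, q3, q4],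
        by simpa [hai, haj] using q5, fun b hb => ?_⟩
      by_cases hbi : b = i
      · simp [hbi, hai, haj, q2, hzi a ha hai haj]
      by_cases hbj : b = j
      · simp [hbj, hai, haj, q3, hzj a ha hai haj]
      · simp [hai, haj, hblock a b ha hai haj hb hbi hbj]
  push Not at hswap
  obtain hcard | ⟨i, hi⟩ := Sᶜ.eq_empty_or_nonempty
  · have hmem : ∀ a, a ∈ S := fun a => by
      by_contra ha
      simpa [hcard] using Finset.mem_compl.2 ha
    refine Or.inr ⟨⟨id, fun a ha => (ha (hmem a)).elim⟩, 0, by omega, ?_⟩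
    have : N = 1 := by
      ext a b
      rw [hS a (hmem a)]
    exact this ▸ isInstructionProduct_one
  left
  rw [Finset.mem_compl] at hi
  have hpred : ∀ a ∉ S, ∃ b ∉ S, N b a = 1 ∧ N a b = 0 ∧ a ≠ b := by
    intro a ha
    obtain ⟨b, hb, hba⟩ := exists_ne_zero_of_isUnit hN hS ha
    exact ⟨b, hb, ZMod_two_eq_one hba, hswap b hb a ha hba, by
      rintro rfl
      exact hba (hdiag a ha)⟩
  obtain ⟨j, hj, hji, hij0, hij⟩ := hpred i hi
  obtain ⟨k, hk, hkj, hjk0, hjk⟩ := hpred j hj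
  obtain ⟨l, hl, hlk, hkl0, hkl⟩ := hpred k hk
  have hik : i ≠ k := by rintro rfl; simp [hij0] at hkj
  have hjl : j ≠ l := by rintro rfl; simp [hjk0] at hlk
  by_cases hil : i = l
  · subst hil
    obtain ⟨H, hH, hc, ei, ej, ek, hrest⟩ := exists_product_of_three_cycle N hij hik hjk
      (hdiag i hi) hij0 hlk hji (hdiag j hj) hjk0 hkl0 hkj (hdiag k hk)
    refine cheap {i, j, k} H 4 hH hc ?_ ?_ (fun s hs => hrest s ?_ ?_ ?_) ?_
    · simp [hi, hj, hk]
    · simp [ei, ej, ek]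
    iterate 3 (rintro rfl; contradiction)
    · rw [Finset.card_eq_three.2 ⟨i, j, k, hij, hik, hjk, rfl⟩]; norm_num
  · exact chain i j k l hi hj hk hl hij hik hil hjk hjl hkl hji (hdiag j hj) hkj (hdiag k hk)
      (by rw [hlk, hjk0]; ring)

theorem mul_row_of_row_eq_one {A P : Matrix (Fin n) (Fin n) F} {a : Fin n}
    (h : A a = (1 : Matrix (Fin n) (Fin n) F) a) : (A * P) a = P a := by
  ext j
  simp [mul_apply, h, one_apply]

section Counting

variable {f : Matrix (Fin n) (Fin n) F → Fin n} {L : List (Matrix (Fin n) (Fin n) F)}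

theorem prod_row_of_count_eq_zero
    (hL : ∀ A ∈ L, ∀ j ≠ f A, A j = (1 : Matrix (Fin n) (Fin n) F) j) {a : Fin n}
    (ha : (L.map f).count a = 0) : L.prod a = (1 : Matrix (Fin n) (Fin n) F) a := by
  induction L with
  | nil => rfl
  | cons A L ih =>
    simp only [List.forall_mem_cons] at hL
    rw [List.map_cons, List.count_cons] at ha
    have hA : a ≠ f A := by
      rintro rfl
      simp at ha
    rw [List.prod_cons, mul_row_of_row_eq_one (hL.1 a hA)]
    exact ih hL.2 (by omega)

/-- Exchanging two coordinates requires at least three updates of these coordinates. -/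
theorem three_le_count_add_count (hU : ∀ A ∈ L, IsUnit A)
    (hL : ∀ A ∈ L, ∀ j ≠ f A, A j = (1 : Matrix (Fin n) (Fin n) F) j) {a b : Fin n} (hab : a ≠ b)
    (ha : L.prod a = (1 : Matrix (Fin n) (Fin n) F) b)
    (hb : L.prod b = (1 : Matrix (Fin n) (Fin n) F) a) :
    3 ≤ (L.map f).count a + (L.map f).count b := by
  have hone : ∀ a b : Fin n, a ≠ b →
      (1 : Matrix (Fin n) (Fin n) F) a ≠ (1 : Matrix (Fin n) (Fin n) F) b := by
    intro a b hab h
    simpa [hab.symm] using congrFun h a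
  induction L generalizing a b with
  | nil => exact absurd ha (hone a b hab)
  | cons A L ih =>
    simp only [List.forall_mem_cons] at hL hU
    -- the last update of the pair `{a, b}` concerns `a`
    have last : ∀ a b : Fin n, a ≠ b → f A = a → (A * L.prod) b = (1 : Matrix _ _ F) a →
        1 ≤ (L.map f).count a ∧ 1 ≤ (L.map f).count b := by
      intro a b hab hA hb
      rw [mul_row_of_row_eq_one (hL.1 b (by rw [hA]; exact hab.symm))] at hb
      refine ⟨Nat.one_le_iff_ne_zero.2 fun h => ?_, Nat.one_le_iff_ne_zero.2 fun h => ?_⟩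
      · have hu : IsUnit L.prod := List.prod_isUnit hU.2
        refine hab ((linearIndependent_rows_iff_isUnit.2 hu).injective ?_)
        exact (prod_row_of_count_eq_zero hL.2 h).trans hb.symm
      · exact hone b a hab.symm ((prod_row_of_count_eq_zero hL.2 h).symm.trans hb)
    rw [List.prod_cons] at ha hb
    rw [List.map_cons, List.count_cons, List.count_cons]
    by_cases hfa : f A = a
    · have := last a b hab hfa hb
      simp only [hfa, beq_self_eq_true, if_true]
      omega
    by_cases hfb : f A = b
    · have := last b a hab.symm hfb ha
      simp only [hfb, beq_self_eq_true, if_true]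
      omega
    · rw [mul_row_of_row_eq_one (hL.1 _ (Ne.symm hfa))] at ha
      rw [mul_row_of_row_eq_one (hL.1 _ (Ne.symm hfb))] at hb
      have := ih hU.2 hL.2 hab ha hb
      omega

end Counting

/-- A fixed-point-free involution of `n` coordinates requires at least `3 * n / 2` instructions. -/
theorem three_mul_le_two_mul_length {L : List (Matrix (Fin n) (Fin n) F)}
    (hL : ∀ A ∈ L, IsUnit A ∧ A.IsLinearInstruction) (σ : Equiv.Perm (Fin n))
    (hinv : ∀ i, σ (σ i) = i) (hfix : ∀ i, σ i ≠ i)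
    (hprod : L.prod = of fun i j => if σ i = j then 1 else 0) : 3 * n ≤ 2 * L.length := by
  obtain rfl | hn := Nat.eq_zero_or_pos n
  · omega
  have : Nonempty (Fin n) := ⟨⟨0, hn⟩⟩
  have hex : ∀ A : Matrix (Fin n) (Fin n) F, ∃ i, A.IsLinearInstruction →
      ∀ j ≠ i, A j = (1 : Matrix (Fin n) (Fin n) F) j := by
    intro A
    by_cases h : A.IsLinearInstruction
    · exact h.imp fun i hi _ => hi
    · exact ⟨Classical.arbitrary _, fun h' => absurd h' h⟩
  choose f hf using hex
  have hrow : ∀ a, L.prod a = (1 : Matrix (Fin n) (Fin n) F) (σ a) := by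
    intro a
    ext j
    rw [hprod, of_apply, one_apply]
  have hcount : ∀ a, 3 ≤ (L.map f).count a + (L.map f).count (σ a) := fun a =>
    three_le_count_add_count (fun A hA => (hL A hA).1) (fun A hA => hf A (hL A hA).2)
      (hfix a).symm (hrow a) (by rw [hrow, hinv])
  have hsum : ∑ a, (L.map f).count a = L.length := by
    have := Multiset.sum_count_eq_card (s := Finset.univ) (m := (L.map f : Multiset (Fin n)))
      (fun _ _ => Finset.mem_univ _)
    simpa using this
  have h1 := Finset.sum_le_sum fun a (_ : a ∈ Finset.univ) => hcount a
  rw [Finset.sum_add_distrib, Equiv.sum_comp σ fun a => (L.map f).count a, hsum] at h1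
  simp at h1
  omega

end Matrix

/-- In `GL(2m, 2)`, the matrices that cannot be written as a product of fewer than `3m`
bijective linear instructions are exactly the permutation matrices of fixed-point-free
involutions. -/
theorem extremal_matrices_over_GF2_iff_fixed_point_free_involution
    (m : ℕ) (hm : 1 ≤ m)
    (M : Matrix (Fin (2 * m)) (Fin (2 * m)) (ZMod 2)) (hM : IsUnit M) :
    (∀ L : List (Matrix (Fin (2 * m)) (Fin (2 * m)) (ZMod 2)),
        (∀ A ∈ L, IsUnit A ∧ A.IsLinearInstruction) → L.prod = M →
        3 * m ≤ L.length) ↔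
    ∃ σ : Equiv.Perm (Fin (2 * m)),
      (∀ i, σ (σ i) = i) ∧ (∀ i, σ i ≠ i) ∧
      M = Matrix.of fun i j => if σ i = j then 1 else 0 := by
  constructor
  · intro h
    obtain ⟨k, hk, L, hL, hprod, rfl⟩ | ⟨⟨σ, hσ⟩, -⟩ :=
      Matrix.hasShortProductOff_or _ M ∅ rfl hM (by simp)
    · have := h L hL hprod
      rw [Finset.compl_empty, Finset.card_univ, Fintype.card_fin] at hk
      omega
    · simp only [Finset.notMem_empty, not_false_eq_true, true_and, forall_const] at hσ
      have hinv : Function.Involutive σ := fun a => (hσ a).1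
      refine ⟨hinv.toPerm, fun a => (hσ a).1, fun a => (hσ a).2.1, ?_⟩
      ext a b
      exact (hσ a).2.2 b
  · rintro ⟨σ, hinv, hfix, rfl⟩ L hL hprod
    have := Matrix.three_mul_le_two_mul_length hL σ hinv hfix hprod
    omega
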